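/- Let D_P^G be the smallest norm-closed *-subalgebra of ℓ^∞(G) (the C*-algebra of bounded complex-valued functions on G) which contains the indicator function 1_P and is invariant under all left-translation operators τ_g, where (τ_g f)(x) = f(g⁻¹x). Then D_P^G equals the closed linear span of {1_Y : Y ∈ 𝒥_P^G}. -/

import Mathlib

variable {G : Type*} [Group G] [TopologicalSpace G] [DiscreteTopology G]

/-- Left translate `g·X = {gx : x ∈ X}`. -/
def lmul (g : G) (X : Set G) : Set G := (g * ·) '' X

/-- `p⁻¹X = {y ∈ P : py ∈ X}`. -/
def presub (P : Submonoid G) (p : G) (X : Set G) : Set G := {y : G | y ∈ P ∧ p * y ∈ X}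

/-- The constructible right ideals of `P`. -/
inductive IsConstructible (P : Submonoid G) : Set G → Prop
  | empty : IsConstructible P ∅
  | base : IsConstructible P (P : Set G)
  | mul {p : G} (hp : p ∈ P) {X : Set G} (hX : IsConstructible P X) : IsConstructible P (lmul p X)
  | pre {p : G} (hp : p ∈ P) {X : Set G} (hX : IsConstructible P X) :
      IsConstructible P (presub P p X)

/-- `𝒥_P^G`. -/
inductive IsConstructibleG (P : Submonoid G) : Set G → Prop
  | base {X : Set G} (hX : IsConstructible P X) : IsConstructibleG P X
  | translate (g : G) {Y : Set G} (hY : IsConstructibleG P Y) : IsConstructibleG P (lmul g Y)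
  | inter {Y₁ Y₂ : Set G} (h1 : IsConstructibleG P Y₁) (h2 : IsConstructibleG P Y₂) :
      IsConstructibleG P (Y₁ ∩ Y₂)

/-- The indicator function `1_Y`, as an element of `ℓ^∞(G)` (realized as the C*-algebra
of bounded continuous functions on the discrete space `G`). -/
noncomputable def indFn (Y : Set G) : BoundedContinuousFunction G ℂ :=
  BoundedContinuousFunction.ofNormedAddCommGroup (Set.indicator Y fun _ => (1 : ℂ))
    continuous_of_discreteTopology 1
    (by
      intro x
      by_cases hx : x ∈ Y <;> simp [Set.indicator, hx])

/-- The left translation operator `τ_g` on `ℓ^∞(G)`: `(τ_g f)(x) = f(g⁻¹x)`. -/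
noncomputable def tau (g : G) (f : BoundedContinuousFunction G ℂ) :
    BoundedContinuousFunction G ℂ :=
  f.compContinuous ⟨fun x => g⁻¹ * x, continuous_of_discreteTopology⟩

theorem mem_lmul_iff {G : Type*} [Group G] (g x : G) (X : Set G) :
    x ∈ lmul g X ↔ g⁻¹ * x ∈ X := by
  simp only [lmul, Set.image_mul_left, Set.mem_preimage]

theorem presub_eq_inter {G : Type*} [Group G] (P : Submonoid G) (p : G) (X : Set G) :
    presub P p X = (P : Set G) ∩ lmul p⁻¹ X := by
  ext x
  simp [presub, mem_lmul_iff]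

theorem indFn_apply {S : Type*} [TopologicalSpace S] [DiscreteTopology S] (Y : Set S) (x : S) :
    indFn Y x = Y.indicator (fun _ => (1 : ℂ)) x := rfl

theorem indFn_empty {S : Type*} [TopologicalSpace S] [DiscreteTopology S] :
    indFn (∅ : Set S) = 0 := by
  ext x
  simp [indFn_apply]

theorem indFn_mul {S : Type*} [TopologicalSpace S] [DiscreteTopology S] (Y Z : Set S) :
    indFn Y * indFn Z = indFn (Y ∩ Z) := by
  classical
  ext x
  by_cases hY : x ∈ Y <;> by_cases hZ : x ∈ Z <;> simp [indFn_apply, hY, hZ]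

theorem star_indFn {S : Type*} [TopologicalSpace S] [DiscreteTopology S] (Y : Set S) :
    star (indFn Y) = indFn Y := by
  ext x
  by_cases hY : x ∈ Y <;> simp [indFn_apply, hY]

theorem tau_indFn (g : G) (Y : Set G) : tau g (indFn Y) = indFn (lmul g Y) := by
  ext x
  change indFn Y (g⁻¹ * x) = _
  by_cases hY : g⁻¹ * x ∈ Y <;> simp [indFn_apply, mem_lmul_iff, hY]

theorem continuous_tau (g : G) : Continuous (tau g) :=
  BoundedContinuousFunction.continuous_compContinuous _

theorem IsConstructible.indFn_mem {P : Submonoid G} {s : Set (BoundedContinuousFunction G ℂ)}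
    (h_zero : 0 ∈ s) (h_mul : ∀ f ∈ s, ∀ h ∈ s, f * h ∈ s) (hP : indFn (P : Set G) ∈ s)
    (h_tau : ∀ g : G, ∀ f ∈ s, tau g f ∈ s) {X : Set G} (hX : IsConstructible P X) :
    indFn X ∈ s := by
  induction hX with
  | empty => rwa [indFn_empty]
  | base => exact hP
  | mul _ _ ih =>
    rw [← tau_indFn]
    exact h_tau _ _ ih
  | pre _ _ ih =>
    rw [presub_eq_inter, ← indFn_mul, ← tau_indFn]
    exact h_mul _ hP _ (h_tau _ _ ih)

theorem IsConstructibleG.indFn_mem {P : Submonoid G} {s : Set (BoundedContinuousFunction G ℂ)}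
    (h_zero : 0 ∈ s) (h_mul : ∀ f ∈ s, ∀ h ∈ s, f * h ∈ s) (hP : indFn (P : Set G) ∈ s)
    (h_tau : ∀ g : G, ∀ f ∈ s, tau g f ∈ s) {Y : Set G} (hY : IsConstructibleG P Y) :
    indFn Y ∈ s := by
  induction hY with
  | base hX => exact hX.indFn_mem h_zero h_mul hP h_tau
  | translate g _ ih =>
    rw [← tau_indFn]
    exact h_tau _ _ ih
  | inter _ _ ih₁ ih₂ =>
    rw [← indFn_mul]
    exact h_mul _ ih₁ _ ih₂

/-- The linear span of the indicator functions of the sets in `𝒥_P^G`. -/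
noncomputable def indSpan (P : Submonoid G) : Submodule ℂ (BoundedContinuousFunction G ℂ) :=
  Submodule.span ℂ (indFn '' {Y : Set G | IsConstructibleG P Y})

theorem IsConstructibleG.indFn_mem_indSpan {P : Submonoid G} {Y : Set G}
    (hY : IsConstructibleG P Y) : indFn Y ∈ indSpan P :=
  Submodule.subset_span ⟨Y, hY, rfl⟩

theorem mul_mem_indSpan {P : Submonoid G} {f h : BoundedContinuousFunction G ℂ}
    (hf : f ∈ indSpan P) (hh : h ∈ indSpan P) : f * h ∈ indSpan P := by
  have := Submodule.mul_mem_mul hf hh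
  rw [indSpan, Submodule.span_mul_span] at this
  refine Submodule.span_le.2 ?_ this
  rintro _ ⟨_, ⟨Y, hY, rfl⟩, _, ⟨Z, hZ, rfl⟩, rfl⟩
  change indFn Y * indFn Z ∈ indSpan P
  rw [indFn_mul]
  exact (hY.inter hZ).indFn_mem_indSpan

theorem star_mem_indSpan {P : Submonoid G} {f : BoundedContinuousFunction G ℂ}
    (hf : f ∈ indSpan P) : star f ∈ indSpan P := by
  induction hf using Submodule.span_induction with
  | mem _ hx =>
    obtain ⟨Y, hY, rfl⟩ := hx
    exact (star_indFn Y).symm ▸ hY.indFn_mem_indSpan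
  | zero => simp
  | add _ _ _ _ hx hy => exact star_add (R := BoundedContinuousFunction G ℂ) _ _ ▸ add_mem hx hy
  | smul c x _ hx =>
    rw [star_smul]
    exact Submodule.smul_mem _ _ hx

theorem tau_mem_indSpan {P : Submonoid G} (g : G) {f : BoundedContinuousFunction G ℂ}
    (hf : f ∈ indSpan P) : tau g f ∈ indSpan P := by
  induction hf using Submodule.span_induction with
  | mem _ hx =>
    obtain ⟨Y, hY, rfl⟩ := hx
    exact (tau_indFn g Y).symm ▸ (hY.translate g).indFn_mem_indSpan
  | zero => exact zero_mem _
  | add _ _ _ _ hx hy => exact add_mem hx hy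
  | smul c _ _ hx => exact Submodule.smul_mem _ c hx


/-- `D_P^G`, the smallest norm-closed `*`-subalgebra of `ℓ^∞(G)` containing `1_P` and
invariant under all `τ_g`, equals the closed linear span of `{1_Y : Y ∈ 𝒥_P^G}`. -/
theorem stmt_5 (P : Submonoid G) :
    ⋂₀ {s : Set (BoundedContinuousFunction G ℂ) |
        IsClosed s ∧ (0 : BoundedContinuousFunction G ℂ) ∈ s ∧
          (∀ f ∈ s, ∀ h ∈ s, f + h ∈ s) ∧ (∀ c : ℂ, ∀ f ∈ s, c • f ∈ s) ∧
          (∀ f ∈ s, ∀ h ∈ s, f * h ∈ s) ∧ (∀ f ∈ s, star f ∈ s) ∧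
          indFn (P : Set G) ∈ s ∧ ∀ g : G, ∀ f ∈ s, tau g f ∈ s} =
      closure (Submodule.span ℂ (indFn '' {Y : Set G | IsConstructibleG P Y}) :
        Set (BoundedContinuousFunction G ℂ)) := by
  change _ = closure (indSpan P : Set (BoundedContinuousFunction G ℂ))
  refine Set.Subset.antisymm (Set.sInter_subset_of_mem ?_) ?_
  · refine ⟨isClosed_closure, (indSpan P).topologicalClosure.zero_mem,
      fun f hf h hh => (indSpan P).topologicalClosure.add_mem hf hh,
      fun c f hf => (indSpan P).topologicalClosure.smul_mem c hf,
      fun f hf h hh => map_mem_closure₂ continuous_mul hf hh fun _ ha _ hb =>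
        mul_mem_indSpan ha hb,
      fun f hf => map_mem_closure continuous_star hf fun _ => star_mem_indSpan,
      subset_closure (IsConstructibleG.base .base).indFn_mem_indSpan,
      fun g f hf => map_mem_closure (continuous_tau g) hf fun _ => tau_mem_indSpan g⟩
  · rintro f hf s ⟨h_closed, h_zero, h_add, h_smul, h_mul, -, hP, h_tau⟩
    refine closure_minimal (fun x hx => ?_) h_closed hf
    induction hx using Submodule.span_induction with
    | mem _ hx =>
      obtain ⟨Y, hY, rfl⟩ := hx
      exact IsConstructibleG.indFn_mem h_zero h_mul hP h_tau hY
    | zero => exact h_zero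
    | add _ _ _ _ hx hy => exact h_add _ hx _ hy
    | smul c _ _ hx => exact h_smul c _ hx
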